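/- arXiv:1401.1039 — 4 statements merged into one kernel-verified Lean document; each statement's English description precedes it below -/
import Mathlib

section
/- Let p ≥ 7 be a prime and ζ ∈ ℂ a primitive p-th root of unity. For integers a, b coprime to p set L_ζ(a,b) = ((ζ^a + 1)/(ζ^a − 1)) · ((ζ^b + 1)/(ζ^b − 1)), where ζ^a denotes the integer power of the nonzero complex number ζ. Let (a_i, b_i) for i = 1,…,n and (ã_j, b̃_j) for j = 1,…,m be pairs of integers coprime to p, and let α_ℓ, c_ℓ for ℓ = 1,…,r be integers with each c_ℓ coprime to p. Assume the identity in ℂ: Σ_{i=1}^n L_ζ(a_i,b_i) − Σ_{j=1}^m L_ζ(ã_j,b̃_j) + Σ_{ℓ=1}^r 4α_ℓ ζ^{c_ℓ}/(ζ^{c_ℓ} − 1)² = 0. Then the following equalities hold in the field ZMod p (inverses taken in ZMod p): (a) Σ_i (a_i b_i)⁻¹ − Σ_j (ã_j b̃_j)⁻¹ + Σ_ℓ α_ℓ (c_ℓ²)⁻¹ = 0; (b) Σ_i (a_i² + b_i² + 1)(a_i b_i)⁻¹ − Σ_j (ã_j² + b̃_j² + 1)(ã_j b̃_j)⁻¹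 − Σ_ℓ α_ℓ (c_ℓ² − 1)(c_ℓ²)⁻¹ = 0; (c) if moreover every c_ℓ = 1, then Σ_i (a_i⁴ + b_i⁴ − 5a_i²b_i² + 3)(a_i b_i)⁻¹ = Σ_j (ã_j⁴ + b̃_j⁴ − 5ã_j²b̃_j² + 3)(ã_j b̃_j)⁻¹. -/
open Finset

/-- The Lefschetz-number expression `((ζ^a+1)/(ζ^a-1))·((ζ^b+1)/(ζ^b-1))`. -/
noncomputable def Lz (ζ : ℂ) (a b : ℤ) : ℂ :=
  ((ζ ^ a + 1) / (ζ ^ a - 1)) * ((ζ ^ b + 1) / (ζ ^ b - 1))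

theorem intCast_ne_zero_of_isCoprime {p : ℕ} [Fact p.Prime] {x : ℤ} (hx : IsCoprime x (p : ℤ)) :
    (x : ZMod p) ≠ 0 := by
  rw [Ne, ZMod.intCast_zmod_eq_zero_iff_dvd _ p]
  intro hdvd
  exact (Nat.prime_iff_prime_int.mp Fact.out).not_isUnit (hx.isUnit_of_dvd' hdvd dvd_rfl)

section TruncatedExp

variable {A : Type*} [CommRing A]

/-- The exponential `exp (x h)` truncated at order `6`, where `u` stands for `1 / 720`. -/
def truncExp (u h x : A) : A :=
  1 + x * h + 360 * u * x ^ 2 * h ^ 2 + 120 * u * x ^ 3 * h ^ 3 + 30 * u * x ^ 4 * h ^ 4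
    + 6 * u * x ^ 5 * h ^ 5

/-- The truncation of `(exp (x h) - 1) / (x h)`. -/
def truncExpQuot (u h x : A) : A :=
  1 + 360 * u * x * h + 120 * u * x ^ 2 * h ^ 2 + 30 * u * x ^ 3 * h ^ 3 + 6 * u * x ^ 4 * h ^ 4

/-- The truncation of `(x h / 2) coth (x h / 2)`. -/
def truncCoth (u h x : A) : A :=
  1 + 60 * u * x ^ 2 * h ^ 2 - u * x ^ 4 * h ^ 4

theorem truncExp_sub_one (u h x : A) :
    truncExp u h x - 1 = h * (x * truncExpQuot u h x) := by
  unfold truncExp truncExpQuot; ring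

theorem truncExp_add {u h : A} (hu : 720 * u = 1) (hh : h ^ 6 = 0) (x y : A) :
    truncExp u h (x + y) = truncExp u h x * truncExp u h y := by
  unfold truncExp; grind

theorem truncExp_pow {u h : A} (hu : 720 * u = 1) (hh : h ^ 6 = 0) (n : ℕ) :
    truncExp u h 1 ^ n = truncExp u h n := by
  induction n with
  | zero => simp [truncExp]
  | succ n ih => rw [pow_succ, ih, Nat.cast_succ, truncExp_add hu hh]

theorem isUnit_truncExpQuot {h : A} (hh : h ^ 6 = 0) (u x : A) :
    IsUnit (truncExpQuot u h x) := by
  have hn : IsNilpotent (h * (360 * u * x + 120 * u * x ^ 2 * h + 30 * u * x ^ 3 * h ^ 2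
      + 6 * u * x ^ 4 * h ^ 3)) := (Commute.all _ _).isNilpotent_mul_right ⟨6, hh⟩
  convert hn.isUnit_one_add using 1
  unfold truncExpQuot; ring

theorem mul_truncExp_add_one {u h : A} (hu : 720 * u = 1) (hh : h ^ 6 = 0) (x : A) :
    h * (truncExp u h x + 1) = h * (2 * truncCoth u h x * truncExpQuot u h x) := by
  unfold truncExp truncExpQuot truncCoth; grind

theorem mul_truncCoth_mul_truncCoth {u h : A} (hu : 720 * u = 1) (hh : h ^ 6 = 0) (x y : A) :
    h * (truncCoth u h x * truncCoth u h y) =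
      h + 60 * u * (x ^ 2 + y ^ 2) * h ^ 3
        - u * (x ^ 4 + y ^ 4 - 5 * x ^ 2 * y ^ 2) * h ^ 5 := by
  unfold truncCoth; grind

open Polynomial in
theorem aeval_truncExp_eq_zero {p : ℕ} [Fact p.Prime] (hp7 : 7 ≤ p) [Algebra (ZMod p) A]
    {h : A} (hh : h ^ 6 = 0) (u : A) {ζ : ℂ} (hζ : IsPrimitiveRoot ζ p) {F : ℤ[X]}
    (hF : aeval ζ F = 0) : aeval (truncExp u h 1) F = 0 := by
  have hp : p.Prime := Fact.out
  have hdvd : cyclotomic p ℤ ∣ F := by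
    rw [cyclotomic_eq_minpoly hζ hp.pos]
    exact minpoly.isIntegrallyClosed_dvd (hζ.isIntegral hp.pos) hF
  have hcyc : cyclotomic p (ZMod p) = (X - 1) ^ (p - 1) := by
    refine mul_right_cancel₀ (X_sub_C_ne_zero (1 : ZMod p)) ?_
    rw [C_1, cyclotomic_prime_mul_X_sub_one, ← pow_succ, Nat.sub_add_cancel hp.one_le,
      sub_pow_char, one_pow]
  have hzero : aeval (truncExp u h 1) (cyclotomic p ℤ) = 0 := by
    rw [← aeval_map_algebraMap (ZMod p), map_cyclotomic, hcyc, map_pow, map_sub, aeval_X, map_one,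
      truncExp_sub_one, mul_pow, pow_eq_zero_of_le (by omega) hh, zero_mul]
  obtain ⟨G, rfl⟩ := hdvd
  rw [map_mul, hzero, zero_mul]

open Polynomial in
/-- The cyclotomic integer `(ζ - 1) (ζ ^ a + 1) / (ζ ^ a - 1)`, with its expansion under
`ζ ↦ exp h`. -/
theorem exists_polynomial_lift {p : ℕ} [Fact p.Prime] [Algebra (ZMod p) A]
    {u h : A} (hu : 720 * u = 1) (hh : h ^ 6 = 0) {ζ : ℂ} (hζ : IsPrimitiveRoot ζ p)
    (a : ℤ) (ha : IsCoprime a (p : ℤ)) :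
    ∃ P : ℤ[X], aeval ζ P = (ζ - 1) * ((ζ ^ a + 1) / (ζ ^ a - 1)) ∧
      h * (a * aeval (truncExp u h 1) P) = h * (2 * truncCoth u h a * truncExpQuot u h 1) := by
  have hp : p.Prime := Fact.out
  have ha0 : (a : ZMod p) ≠ 0 := intCast_ne_zero_of_isCoprime ha
  set s := (a : ZMod p).val with hs
  set t := ((a : ZMod p)⁻¹).val with ht
  have hst : ((s * t : ℕ) : ZMod p) = 1 := by
    rw [Nat.cast_mul, hs, ht, ZMod.natCast_zmod_val, ZMod.natCast_zmod_val, mul_inv_cancel₀ ha0]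
  have hsA : (s : A) = a := by
    rw [← map_natCast (algebraMap (ZMod p) A), hs, ZMod.natCast_zmod_val, map_intCast]
  have hstA : ((s * t : ℕ) : A) = 1 := by
    rw [← map_natCast (algebraMap (ZMod p) A), hst, map_one]
  have hζa : ζ ^ a = ζ ^ s := by
    have hsa : (p : ℤ) ∣ a - s := by
      rw [← ZMod.intCast_zmod_eq_zero_iff_dvd, Int.cast_sub, Int.cast_natCast, hs,
        ZMod.natCast_zmod_val, sub_self]
    have h1 := (hζ.zpow_eq_one_iff_dvd _).mpr hsa
    rw [zpow_sub₀ (hζ.ne_zero hp.ne_zero), zpow_natCast,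
      div_eq_one_iff_eq (pow_ne_zero _ (hζ.ne_zero hp.ne_zero))] at h1
    exact h1
  have hζ1 : ζ ^ s - 1 ≠ 0 := by
    rw [sub_ne_zero, Ne, hζ.pow_eq_one_iff_dvd, ← ZMod.natCast_eq_zero_iff, hs,
      ZMod.natCast_zmod_val]
    exact ha0
  have hζst : (ζ ^ s) ^ t = ζ := by
    have h1 : s * t ≡ 1 [MOD p] := (ZMod.natCast_eq_natCast_iff _ _ _).mp (by rw [hst, Nat.cast_one])
    rw [← pow_mul, ← pow_mod_orderOf, ← hζ.eq_orderOf, h1, hζ.eq_orderOf, pow_mod_orderOf, pow_one]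
  refine ⟨(X ^ s + 1) * ∑ k ∈ Finset.range t, (X ^ s) ^ k, ?_, ?_⟩
  · simp only [map_mul, map_add, map_sum, map_pow, aeval_X, map_one]
    rw [hζa, ← mul_div_assoc, eq_div_iff hζ1, mul_assoc, geom_sum_mul, hζst, mul_comm]
  · simp only [map_mul, map_add, map_sum, map_pow, aeval_X, map_one]
    have hgeom := geom_sum_mul (truncExp u h 1 ^ s) t
    rw [← pow_mul, truncExp_pow hu hh, truncExp_pow hu hh, hsA, hstA, truncExp_sub_one,
      truncExp_sub_one] at hgeom
    rw [truncExp_pow hu hh, hsA]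
    refine (isUnit_truncExpQuot hh u (a : A)).mul_right_cancel ?_
    linear_combination (truncExp u h a + 1) * hgeom
      + truncExpQuot u h 1 * mul_truncExp_add_one hu hh (a : A)

theorem mul_mul_eq_of_mul_truncCoth {u h : A} (hu : 720 * u = 1) (hh : h ^ 6 = 0)
    {x y v P Q g : A} (hv : x * y * v = 1)
    (hP : h * (x * P) = h * (2 * truncCoth u h x * g))
    (hQ : h * (y * Q) = h * (2 * truncCoth u h y * g)) :
    h * (P * Q) = 4 * g ^ 2 * (v * h + 60 * u * ((x ^ 2 + y ^ 2) * v) * h ^ 3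
      - u * ((x ^ 4 + y ^ 4 - 5 * x ^ 2 * y ^ 2) * v) * h ^ 5) := by
  linear_combination (-h * P * Q) * hv + v * y * Q * hP + v * (2 * truncCoth u h x * g) * hQ
    + 4 * g ^ 2 * v * mul_truncCoth_mul_truncCoth hu hh x y

end TruncatedExp

open Polynomial in
theorem eq_zero_of_X_pow_six_dvd {K : Type*} [Field K] {s₀ s₂ s₄ : K}
    (hdvd : (X : K[X]) ^ 6 ∣ C s₀ * X + C s₂ * X ^ 3 + C s₄ * X ^ 5) :
    s₀ = 0 ∧ s₂ = 0 ∧ s₄ = 0 := by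
  rw [X_pow_dvd_iff] at hdvd
  refine ⟨?_, ?_, ?_⟩
  · simpa [coeff_X, coeff_X_pow] using hdvd 1 (by norm_num)
  · simpa [coeff_X, coeff_X_pow] using hdvd 3 (by norm_num)
  · simpa [coeff_X, coeff_X_pow] using hdvd 5 (by norm_num)

/-- `y = g ^ 2 * (s₀ + s₂ h ^ 2 + s₄ h ^ 4)` up to elements killed by `h`. -/
def HasEvenJet {K A : Type*} [Field K] [CommRing A] [Algebra K A] (h g y : A) (s₀ s₂ s₄ : K) :
    Prop :=
  h * y = g ^ 2 * (algebraMap K A s₀ * h + algebraMap K A s₂ * h ^ 3 + algebraMap K A s₄ * h ^ 5)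

namespace HasEvenJet

variable {K A : Type*} [Field K] [CommRing A] [Algebra K A] {h g y z : A}
  {s₀ s₂ s₄ t₀ t₂ t₄ : K}

theorem add (hy : HasEvenJet h g y s₀ s₂ s₄) (hz : HasEvenJet h g z t₀ t₂ t₄) :
    HasEvenJet h g (y + z) (s₀ + t₀) (s₂ + t₂) (s₄ + t₄) := by
  unfold HasEvenJet at *
  simp only [map_add]
  linear_combination hy + hz

theorem sub (hy : HasEvenJet h g y s₀ s₂ s₄) (hz : HasEvenJet h g z t₀ t₂ t₄) :
    HasEvenJet h g (y - z) (s₀ - t₀) (s₂ - t₂) (s₄ - t₄) := by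
  unfold HasEvenJet at *
  simp only [map_sub]
  linear_combination hy - hz

theorem intCast_mul (hy : HasEvenJet h g y s₀ s₂ s₄) (k : ℤ) :
    HasEvenJet h g (k * y) (k * s₀) (k * s₂) (k * s₄) := by
  unfold HasEvenJet at *
  simp only [map_mul, map_intCast]
  linear_combination k * hy

theorem sum {ι : Type*} (s : Finset ι) {y : ι → A} {s₀ s₂ s₄ : ι → K}
    (hy : ∀ i, HasEvenJet h g (y i) (s₀ i) (s₂ i) (s₄ i)) :
    HasEvenJet h g (∑ i ∈ s, y i) (∑ i ∈ s, s₀ i) (∑ i ∈ s, s₂ i) (∑ i ∈ s, s₄ i) := by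
  classical
  induction s using Finset.induction_on with
  | empty => simp [HasEvenJet]
  | insert i s hi ih => simpa only [Finset.sum_insert hi] using (hy i).add ih

open Polynomial in
theorem eq_zero {g y : K[X] ⧸ Ideal.span {(X : K[X]) ^ 6}}
    (hy : HasEvenJet (Ideal.Quotient.mk _ X) g y s₀ s₂ s₄) (hg : IsUnit g) (hy0 : y = 0) :
    s₀ = 0 ∧ s₂ = 0 ∧ s₄ = 0 := by
  refine eq_zero_of_X_pow_six_dvd ?_
  rw [← Ideal.mem_span_singleton, ← Ideal.Quotient.eq_zero_iff_mem]
  refine (hg.pow 2).mul_left_cancel ?_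
  rw [mul_zero]
  rw [HasEvenJet, hy0, mul_zero] at hy
  simp only [map_add, map_mul, map_pow]
  exact hy.symm

end HasEvenJet

theorem hasEvenJet_mul {K A : Type*} [Field K] [CommRing A] [Algebra K A] {h g P Q : A}
    (h720 : (720 : K) ≠ 0) (hh : h ^ 6 = 0) {x y : ℤ} (hx : (x : K) ≠ 0) (hy : (y : K) ≠ 0)
    (hP : h * (x * P) = h * (2 * truncCoth (algebraMap K A 720⁻¹) h x * g))
    (hQ : h * (y * Q) = h * (2 * truncCoth (algebraMap K A 720⁻¹) h y * g)) :
    HasEvenJet h g (P * Q) (4 * ((x * y : ℤ) : K)⁻¹)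
      (240 * 720⁻¹ * (((x ^ 2 + y ^ 2 : ℤ) : K) * ((x * y : ℤ) : K)⁻¹))
      (-4 * 720⁻¹ * (((x ^ 4 + y ^ 4 - 5 * x ^ 2 * y ^ 2 : ℤ) : K) * ((x * y : ℤ) : K)⁻¹)) := by
  have hu : 720 * algebraMap K A 720⁻¹ = 1 := by
    rw [← map_ofNat (algebraMap K A), ← map_mul, mul_inv_cancel₀ h720, map_one]
  have hv : (x : A) * y * algebraMap K A ((x * y : ℤ) : K)⁻¹ = 1 := by
    rw [← Int.cast_mul, ← map_intCast (algebraMap K A), ← map_mul, mul_inv_cancel₀, map_one]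
    rw [Int.cast_mul]
    exact mul_ne_zero hx hy
  unfold HasEvenJet
  rw [mul_mul_eq_of_mul_truncCoth hu hh hv hP hQ]
  simp only [map_mul, map_intCast, map_ofNat, map_neg]
  push_cast
  ring

/-- The G-signature identity at a primitive `p`-th root of unity forces the
mod-`p` congruences among the order 0, 2 and 4 Taylor coefficients at `t = 1`. -/
theorem stmt3 (p : ℕ) (hp : p.Prime) (hp7 : 7 ≤ p) (ζ : ℂ) (hζ : IsPrimitiveRoot ζ p)
    (n m r : ℕ) (a b : Fin n → ℤ) (a' b' : Fin m → ℤ) (α c : Fin r → ℤ)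
    (ha : ∀ i, IsCoprime (a i) (p : ℤ)) (hb : ∀ i, IsCoprime (b i) (p : ℤ))
    (ha' : ∀ j, IsCoprime (a' j) (p : ℤ)) (hb' : ∀ j, IsCoprime (b' j) (p : ℤ))
    (hc : ∀ l, IsCoprime (c l) (p : ℤ))
    (hid : ∑ i, Lz ζ (a i) (b i) - ∑ j, Lz ζ (a' j) (b' j)
        + ∑ l, 4 * (α l : ℂ) * ζ ^ (c l) / (ζ ^ (c l) - 1) ^ 2 = 0) :
    (∑ i, ((a i * b i : ℤ) : ZMod p)⁻¹ - ∑ j, ((a' j * b' j : ℤ) : ZMod p)⁻¹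
        + ∑ l, (α l : ZMod p) * (((c l) ^ 2 : ℤ) : ZMod p)⁻¹ = 0) ∧
    (∑ i, (((a i) ^ 2 + (b i) ^ 2 + 1 : ℤ) : ZMod p) * ((a i * b i : ℤ) : ZMod p)⁻¹
        - ∑ j, (((a' j) ^ 2 + (b' j) ^ 2 + 1 : ℤ) : ZMod p) * ((a' j * b' j : ℤ) : ZMod p)⁻¹
        - ∑ l, (α l : ZMod p) * (((c l) ^ 2 - 1 : ℤ) : ZMod p)
            * (((c l) ^ 2 : ℤ) : ZMod p)⁻¹ = 0) ∧
    ((∀ l, c l = 1) →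
      ∑ i, (((a i) ^ 4 + (b i) ^ 4 - 5 * (a i) ^ 2 * (b i) ^ 2 + 3 : ℤ) : ZMod p)
          * ((a i * b i : ℤ) : ZMod p)⁻¹
        = ∑ j, (((a' j) ^ 4 + (b' j) ^ 4 - 5 * (a' j) ^ 2 * (b' j) ^ 2 + 3 : ℤ) : ZMod p)
            * ((a' j * b' j : ℤ) : ZMod p)⁻¹) := by
  have : Fact p.Prime := ⟨hp⟩
  have hcast {x : ℤ} (hx : IsCoprime x (p : ℤ)) : (x : ZMod p) ≠ 0 :=
    intCast_ne_zero_of_isCoprime hx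
  have h720 : (720 : ZMod p) ≠ 0 := by
    have h1 : ¬ p ∣ 720 := by
      rw [show 720 = 2 ^ 4 * 3 ^ 2 * 5 by norm_num, hp.dvd_mul, hp.dvd_mul]
      rintro ((h | h) | h)
      · exact absurd (Nat.le_of_dvd (by norm_num) (hp.dvd_of_dvd_pow h)) (by omega)
      · exact absurd (Nat.le_of_dvd (by norm_num) (hp.dvd_of_dvd_pow h)) (by omega)
      · exact absurd (Nat.le_of_dvd (by norm_num) h) (by omega)
    rw [← ZMod.natCast_eq_zero_iff] at h1
    exact_mod_cast h1
  let A := Polynomial (ZMod p) ⧸ Ideal.span {(Polynomial.X : Polynomial (ZMod p)) ^ 6}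
  let h : A := Ideal.Quotient.mk _ Polynomial.X
  let u : A := algebraMap (ZMod p) A 720⁻¹
  let g : A := truncExpQuot u h 1
  have hh : h ^ 6 = 0 := by
    rw [← map_pow, Ideal.Quotient.eq_zero_iff_mem]
    exact Ideal.mem_span_singleton_self _
  have hu : 720 * u = 1 := by
    rw [← map_ofNat (algebraMap (ZMod p) A), ← map_mul, mul_inv_cancel₀ h720, map_one]
  have hlift := fun x hx ↦ exists_polynomial_lift hu hh hζ x hx
  choose Pa hPa hPa' using fun i ↦ hlift (a i) (ha i)
  choose Pb hPb hPb' using fun i ↦ hlift (b i) (hb i)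
  choose Qa hQa hQa' using fun j ↦ hlift (a' j) (ha' j)
  choose Qb hQb hQb' using fun j ↦ hlift (b' j) (hb' j)
  choose R hR hR' using fun l ↦ hlift (c l) (hc l)
  let ψ := Polynomial.aeval (R := ℤ) (truncExp u h 1)
  let F : Polynomial ℤ := ∑ i, Pa i * Pb i - ∑ j, Qa j * Qb j
    + ∑ l, (α l : Polynomial ℤ) * (R l * R l - (Polynomial.X - 1) ^ 2)
  have hζc (l : Fin r) : ζ ^ c l - 1 ≠ 0 := by
    rw [sub_ne_zero, Ne, hζ.zpow_eq_one_iff_dvd, ← ZMod.intCast_zmod_eq_zero_iff_dvd]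
    exact hcast (hc l)
  have hFζ : Polynomial.aeval ζ F = 0 := by
    rw [← mul_zero ((ζ - 1) ^ 2), ← hid]
    simp only [F, Lz, map_add, map_sub, map_sum, map_mul, map_pow, map_one, map_intCast,
      Polynomial.aeval_X, hPa, hPb, hQa, hQb, hR, mul_add, mul_sub, mul_sum]
    congr 1
    · congr 1 <;> exact sum_congr rfl fun _ _ ↦ by ring
    · refine sum_congr rfl fun l _ ↦ ?_
      have := hζc l
      field_simp
      ring
  have hF : ψ F = 0 := aeval_truncExp_eq_zero hp7 hh u hζ hFζ
  have hjet1 : HasEvenJet h g ((ψ Polynomial.X - ψ 1) ^ 2) (0 : ZMod p) 1 0 := by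
    simp only [HasEvenJet, ψ, g, map_one, map_zero, Polynomial.aeval_X,
      truncExp_sub_one]
    ring
  simp only [F, map_add, map_sub, map_sum, map_mul ψ, map_pow ψ, map_intCast] at hF
  have hjet := ((HasEvenJet.sum univ fun i ↦ hasEvenJet_mul h720 hh (hcast (ha i)) (hcast (hb i))
      (hPa' i) (hPb' i)).sub (HasEvenJet.sum univ fun j ↦ hasEvenJet_mul h720 hh (hcast (ha' j))
      (hcast (hb' j)) (hQa' j) (hQb' j))).add (HasEvenJet.sum univ fun l ↦
      ((hasEvenJet_mul h720 hh (hcast (hc l)) (hcast (hc l)) (hR' l) (hR' l)).sub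
        hjet1).intCast_mul (α l))
  obtain ⟨h0, h2, h4⟩ := hjet.eq_zero (isUnit_truncExpQuot hh u 1) hF
  have hcv (l : Fin r) : ((c l : ZMod p)) ^ 2 * (((c l) ^ 2 : ℤ) : ZMod p)⁻¹ = 1 := by
    rw [← Int.cast_pow]
    exact mul_inv_cancel₀ (by rw [Int.cast_pow]; exact pow_ne_zero 2 (hcast (hc l)))
  have hw : (720 : ZMod p) * 720⁻¹ = 1 := mul_inv_cancel₀ h720
  have hw0 : (720 : ZMod p)⁻¹ ≠ 0 := inv_ne_zero h720
  have h4ne : (4 : ZMod p) ≠ 0 := fun h' ↦ h720 (by linear_combination 180 * h')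
  have h240ne : (240 : ZMod p) ≠ 0 := fun h' ↦ h720 (by linear_combination 3 * h')
  have e0 : ∑ i, ((a i * b i : ℤ) : ZMod p)⁻¹ - ∑ j, ((a' j * b' j : ℤ) : ZMod p)⁻¹
      + ∑ l, (α l : ZMod p) * (((c l) ^ 2 : ℤ) : ZMod p)⁻¹ = 0 := by
    refine (mul_eq_zero_iff_left h4ne).mp (Eq.trans ?_ h0)
    simp only [mul_add, mul_sub, mul_sum, sub_zero, ← pow_two]
    congr 1
    exact sum_congr rfl fun l _ ↦ by ring
  have e2 : ∑ i, (((a i) ^ 2 + (b i) ^ 2 : ℤ) : ZMod p) * ((a i * b i : ℤ) : ZMod p)⁻¹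
      - ∑ j, (((a' j) ^ 2 + (b' j) ^ 2 : ℤ) : ZMod p) * ((a' j * b' j : ℤ) : ZMod p)⁻¹
      - ∑ l, (α l : ZMod p) = 0 := by
    refine (mul_eq_zero_iff_left (mul_ne_zero h240ne hw0)).mp (Eq.trans ?_ h2)
    simp only [mul_sub, mul_sum, ← pow_two, sub_eq_add_neg _ (∑ l, _ * (α l : ZMod p)),
      ← sum_neg_distrib]
    congr 1
    refine sum_congr rfl fun l _ ↦ ?_
    push_cast
    have h' := hcv l
    push_cast at h'
    linear_combination (-480 * 720⁻¹ * (α l : ZMod p)) * h' - (α l : ZMod p) * hw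
  have e4 : ∑ i, (((a i) ^ 4 + (b i) ^ 4 - 5 * (a i) ^ 2 * (b i) ^ 2 : ℤ) : ZMod p)
        * ((a i * b i : ℤ) : ZMod p)⁻¹
      - ∑ j, (((a' j) ^ 4 + (b' j) ^ 4 - 5 * (a' j) ^ 2 * (b' j) ^ 2 : ℤ) : ZMod p)
        * ((a' j * b' j : ℤ) : ZMod p)⁻¹
      - ∑ l, 3 * ((α l : ZMod p) * (c l : ZMod p) ^ 2) = 0 := by
    refine (mul_eq_zero_iff_left (mul_ne_zero (neg_ne_zero.mpr h4ne) hw0)).mp (Eq.trans ?_ h4)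
    simp only [mul_sub, mul_sum, ← pow_two, sub_zero,
      sub_eq_add_neg _ (∑ l, _ * (3 * ((α l : ZMod p) * (c l : ZMod p) ^ 2))), ← sum_neg_distrib]
    congr 1
    refine sum_congr rfl fun l _ ↦ ?_
    push_cast
    have h' := hcv l
    push_cast at h'
    linear_combination (-12 * 720⁻¹ * (α l : ZMod p) * (c l : ZMod p) ^ 2) * h'
  refine ⟨e0, ?_, fun hc1 ↦ ?_⟩
  · have e (l : Fin r) : (α l : ZMod p) * (((c l) ^ 2 - 1 : ℤ) : ZMod p)
        * (((c l) ^ 2 : ℤ) : ZMod p)⁻¹ = α l - α l * (((c l) ^ 2 : ℤ) : ZMod p)⁻¹ := by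
      rw [Int.cast_sub, Int.cast_one, Int.cast_pow (c l) 2]
      have h' := hcv l
      push_cast at h'
      linear_combination (α l : ZMod p) * h'
    simp only [e, sum_sub_distrib, Int.cast_add _ (1 : ℤ), Int.cast_one, add_mul _ (1 : ZMod p),
      one_mul, sum_add_distrib]
    linear_combination e0 + e2
  · simp only [hc1, Int.cast_one, one_pow, mul_one, inv_one, ← mul_sum] at e0 e4
    simp only [Int.cast_add _ (3 : ℤ), add_mul _ ((3 : ℤ) : ZMod p), sum_add_distrib, ← mul_sum]
    push_cast at e0 e4 ⊢
    linear_combination e4 + 3 * e0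
end

section
/- Let ζ ∈ ℂ be any primitive 7th root of unity. For integers a, b not divisible by 7 set L_ζ(a,b) = ((ζ^a + 1)/(ζ^a − 1)) · ((ζ^b + 1)/(ζ^b − 1)), where ζ^a denotes the integer power of the nonzero complex number ζ. Let D denote the list of nine pairs [(1,1), (1,1), (1,1), (1,−3), (1,−1), (1,−1), (2,2), (2,2), (3,3)] and P the list of seven pairs [(−4,5), (−3,4), (−2,3), (−2,3), (−1,2), (−1,2), (−1,2)]. Then Σ_{(a,b)∈D} L_ζ(a,b) = Σ_{(c,d)∈P} L_ζ(c,d) + 8ζ/(ζ − 1)². -/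
open Finset

/-- Rotation data solving the G-signature theorem at `p = 7`. -/
def Ddata : Fin 9 → ℤ × ℤ :=
  ![(1, 1), (1, 1), (1, 1), (1, -3), (1, -1), (1, -1), (2, 2), (2, 2), (3, 3)]

/-- The rotation data of the seven isolated fixed points of the equivariant
`E8`-plumbing action. -/
def Pdata : Fin 7 → ℤ × ℤ :=
  ![(-4, 5), (-3, 4), (-2, 3), (-2, 3), (-1, 2), (-1, 2), (-1, 2)]

lemma Lz_comm (ζ : ℂ) (a b : ℤ) : Lz ζ a b = Lz ζ b a := mul_comm _ _

lemma Lz_neg_left {ζ : ℂ} (hζ : ζ ≠ 0) (a b : ℤ) : Lz ζ (-a) b = -Lz ζ a b := by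
  have h : (ζ ^ (-a) + 1) / (ζ ^ (-a) - 1) = -((ζ ^ a + 1) / (ζ ^ a - 1)) := by
    have ha : ζ ^ a ≠ 0 := zpow_ne_zero a hζ
    rw [zpow_neg, ← mul_div_mul_left _ _ ha, mul_add, mul_sub, mul_inv_cancel₀ ha, mul_one,
      ← div_neg, neg_sub, add_comm]
  rw [Lz, Lz, h, neg_mul]

lemma Lz_neg_right {ζ : ℂ} (hζ : ζ ≠ 0) (a b : ℤ) : Lz ζ a (-b) = -Lz ζ a b := by
  rw [Lz_comm, Lz_neg_left hζ, Lz_comm]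

lemma Lz_add_order_left {ζ : ℂ} {n : ℕ} [NeZero n] (hζ : IsPrimitiveRoot ζ n) (a b : ℤ) :
    Lz ζ (a + n) b = Lz ζ a b := by
  rw [Lz, Lz, zpow_add₀ (hζ.ne_zero (NeZero.ne n)), zpow_natCast, hζ.pow_eq_one, mul_one]

/-- The addition formula for the hyperbolic cotangent, in terms of `Lz`. -/
lemma Lz_addition {ζ : ℂ} (hζ : ζ ≠ 0) {a b : ℤ} (ha : ζ ^ a ≠ 1) (hb : ζ ^ b ≠ 1)
    (hab : ζ ^ (a + b) ≠ 1) :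
    Lz ζ (a + b) a + Lz ζ (a + b) b = Lz ζ a b + 1 := by
  rw [zpow_add₀ hζ] at hab
  simp only [Lz, zpow_add₀ hζ]
  have ha' := sub_ne_zero.2 ha
  have hb' := sub_ne_zero.2 hb
  have hab' := sub_ne_zero.2 hab
  field_simp
  ring

lemma eight_mul_div_sub_one_sq {ζ : ℂ} (hζ : ζ ≠ 1) :
    8 * ζ / (ζ - 1) ^ 2 = 2 * (Lz ζ 1 1 - 1) := by
  have h := sub_ne_zero.2 hζ
  simp only [Lz, zpow_one]
  field_simp
  ring

/-- For any primitive 7th root of unity `ζ`, the rotation data `D` satisfy the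
G-signature identity against the `E8`-plumbing data `P`. -/
theorem stmt5 (ζ : ℂ) (hζ : IsPrimitiveRoot ζ 7) :
    ∑ i, Lz ζ (Ddata i).1 (Ddata i).2
      = ∑ j, Lz ζ (Pdata j).1 (Pdata j).2 + 8 * ζ / (ζ - 1) ^ 2 := by
  have h0 : ζ ≠ 0 := hζ.ne_zero (by norm_num)
  have hne {a : ℤ} (ha : ¬(7 : ℤ) ∣ a) : ζ ^ a ≠ 1 :=
    fun h => ha ((hζ.zpow_eq_one_iff_dvd a).1 h)
  have h2 := Lz_addition h0 (hne (a := 1) (by norm_num)) (hne (a := 1) (by norm_num))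
    (hne (by norm_num))
  have h3 := Lz_addition h0 (hne (a := 1) (by norm_num)) (hne (a := 2) (by norm_num))
    (hne (by norm_num))
  have h4 := Lz_addition h0 (hne (a := 2) (by norm_num)) (hne (a := 2) (by norm_num))
    (hne (by norm_num))
  norm_num only at h2 h3 h4
  have hfour (b : ℤ) : Lz ζ 4 b = -Lz ζ 3 b := by
    simpa [Lz_neg_left h0] using Lz_add_order_left hζ (-3) b
  have hfive (b : ℤ) : Lz ζ 5 b = -Lz ζ 2 b := by
    simpa [Lz_neg_left h0] using Lz_add_order_left hζ (-2) b
  simp only [Fin.sum_univ_succ, Fin.sum_univ_zero, Ddata, Pdata, Matrix.cons_val_zero,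
    Matrix.cons_val_succ, Lz_neg_left h0, Lz_neg_right h0, Lz_comm ζ 3 5, Lz_comm ζ 3 4, hfour, hfive,
    eight_mul_div_sub_one_sq (hζ.ne_one (by norm_num))]
  rw [hfour] at h4
  linear_combination h2 - h3 - 2 * h4 + 2 * Lz_comm ζ 1 2 - Lz_comm ζ 1 3 + 3 * Lz_comm ζ 2 3
end

section
/- Let p be a prime and a₁, a₂, a₃ nonzero integers, and let b₁, b₂, b₃ be integers with b₁a₂a₃ + a₁b₂a₃ + a₁a₂b₃ = p (equivalently b₁/a₁ + b₂/a₂ + b₃/a₃ = p/(a₁a₂a₃) =: S, a nonzero rational). Let n₀ and σ_j, ρ_j (j = 1,2,3) be integers satisfying a_jσ_j − b_jρ_j = 1. Then the rational number −Σ_{j=1}^{3} (ρ_j b_j² + b_j(n₀ + S)/S)/a_j − n₀(n₀ + S)/S + n₀²a₁a₂a₃/p is an integer. In particular, the expression −Σ_{j=1}^{3} (ρ_j b_j² + b_j(n₀ + S)/S)/a_j − n₀(n₀ + S)/S is congruent modulo ℤ to a rational number of the form n/p with n ∈ ℤ. -/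
theorem seifert_term_eq {K : Type*} [Field K] {a b σ ρ n S : K} (ha : a ≠ 0) (hS : S ≠ 0)
    (h : a * σ - b * ρ = 1) :
    (ρ * b ^ 2 + b * (n + S) / S) / a = b * σ + n * (b / a) / S := by
  field_simp
  linear_combination (-b * S) * h

theorem auckly_expression_eq {K : Type*} [Field K]
    {a₁ a₂ a₃ b₁ b₂ b₃ σ₁ σ₂ σ₃ ρ₁ ρ₂ ρ₃ n S : K}
    (ha₁ : a₁ ≠ 0) (ha₂ : a₂ ≠ 0) (ha₃ : a₃ ≠ 0) (hS : S ≠ 0)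
    (hb : b₁ / a₁ + b₂ / a₂ + b₃ / a₃ = S) (h₁ : a₁ * σ₁ - b₁ * ρ₁ = 1)
    (h₂ : a₂ * σ₂ - b₂ * ρ₂ = 1) (h₃ : a₃ * σ₃ - b₃ * ρ₃ = 1) :
    -((ρ₁ * b₁ ^ 2 + b₁ * (n + S) / S) / a₁ + (ρ₂ * b₂ ^ 2 + b₂ * (n + S) / S) / a₂
        + (ρ₃ * b₃ ^ 2 + b₃ * (n + S) / S) / a₃) - n * (n + S) / S
      = -(b₁ * σ₁ + b₂ * σ₂ + b₃ * σ₃) - 2 * n - n ^ 2 / S := by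
  rw [seifert_term_eq ha₁ hS h₁, seifert_term_eq ha₂ hS h₂, seifert_term_eq ha₃ hS h₃]
  have hn : n * (n + S) / S = n ^ 2 / S + n := by field_simp
  have hsum : n * (b₁ / a₁) / S + n * (b₂ / a₂) / S + n * (b₃ / a₃) / S = n := by
    rw [← add_div, ← add_div, ← mul_add, ← mul_add, hb, mul_div_cancel_right₀ _ hS]
  linear_combination -hn - hsum

/-- Simplification of Auckly's formula for the Chern–Simons invariant of a
reducible flat connection on the quotient `Q = Σ(a₁,a₂,a₃)/(ℤ/p)`: with
`S = p/(a₁a₂a₃)`, the rational number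
`-Σⱼ (ρⱼbⱼ² + bⱼ(n₀+S)/S)/aⱼ - n₀(n₀+S)/S + n₀²a₁a₂a₃/p` is an integer; in
particular the expression without the last term is congruent mod `ℤ` to a
rational of the form `n/p`. -/
theorem stmt8 (p : ℕ) (hp : p.Prime) (a₁ a₂ a₃ : ℤ)
    (ha₁ : a₁ ≠ 0) (ha₂ : a₂ ≠ 0) (ha₃ : a₃ ≠ 0)
    (b₁ b₂ b₃ : ℤ) (hb : b₁ * a₂ * a₃ + a₁ * b₂ * a₃ + a₁ * a₂ * b₃ = p)
    (n₀ σ₁ σ₂ σ₃ ρ₁ ρ₂ ρ₃ : ℤ)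
    (h₁ : a₁ * σ₁ - b₁ * ρ₁ = 1) (h₂ : a₂ * σ₂ - b₂ * ρ₂ = 1)
    (h₃ : a₃ * σ₃ - b₃ * ρ₃ = 1) :
    (∃ z : ℤ,
      -(((ρ₁ : ℚ) * (b₁ : ℚ) ^ 2 + (b₁ : ℚ) * ((n₀ : ℚ) + (p : ℚ) / ((a₁ : ℚ) * a₂ * a₃))
            / ((p : ℚ) / ((a₁ : ℚ) * a₂ * a₃))) / (a₁ : ℚ)
        + ((ρ₂ : ℚ) * (b₂ : ℚ) ^ 2 + (b₂ : ℚ) * ((n₀ : ℚ) + (p : ℚ) / ((a₁ : ℚ) * a₂ * a₃))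
            / ((p : ℚ) / ((a₁ : ℚ) * a₂ * a₃))) / (a₂ : ℚ)
        + ((ρ₃ : ℚ) * (b₃ : ℚ) ^ 2 + (b₃ : ℚ) * ((n₀ : ℚ) + (p : ℚ) / ((a₁ : ℚ) * a₂ * a₃))
            / ((p : ℚ) / ((a₁ : ℚ) * a₂ * a₃))) / (a₃ : ℚ))
        - (n₀ : ℚ) * ((n₀ : ℚ) + (p : ℚ) / ((a₁ : ℚ) * a₂ * a₃))
            / ((p : ℚ) / ((a₁ : ℚ) * a₂ * a₃))
        + (n₀ : ℚ) ^ 2 * (a₁ : ℚ) * a₂ * a₃ / (p : ℚ) = (z : ℚ)) ∧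
    (∃ n z : ℤ,
      -(((ρ₁ : ℚ) * (b₁ : ℚ) ^ 2 + (b₁ : ℚ) * ((n₀ : ℚ) + (p : ℚ) / ((a₁ : ℚ) * a₂ * a₃))
            / ((p : ℚ) / ((a₁ : ℚ) * a₂ * a₃))) / (a₁ : ℚ)
        + ((ρ₂ : ℚ) * (b₂ : ℚ) ^ 2 + (b₂ : ℚ) * ((n₀ : ℚ) + (p : ℚ) / ((a₁ : ℚ) * a₂ * a₃))
            / ((p : ℚ) / ((a₁ : ℚ) * a₂ * a₃))) / (a₂ : ℚ)
        + ((ρ₃ : ℚ) * (b₃ : ℚ) ^ 2 + (b₃ : ℚ) * ((n₀ : ℚ) + (p : ℚ) / ((a₁ : ℚ) * a₂ * a₃))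
            / ((p : ℚ) / ((a₁ : ℚ) * a₂ * a₃))) / (a₃ : ℚ))
        - (n₀ : ℚ) * ((n₀ : ℚ) + (p : ℚ) / ((a₁ : ℚ) * a₂ * a₃))
            / ((p : ℚ) / ((a₁ : ℚ) * a₂ * a₃))
        - (n : ℚ) / (p : ℚ) = (z : ℚ)) := by
  have hp₀ : (p : ℚ) ≠ 0 := Nat.cast_ne_zero.mpr hp.ne_zero
  have ha₁' : (a₁ : ℚ) ≠ 0 := Int.cast_ne_zero.mpr ha₁
  have ha₂' : (a₂ : ℚ) ≠ 0 := Int.cast_ne_zero.mpr ha₂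
  have ha₃' : (a₃ : ℚ) ≠ 0 := Int.cast_ne_zero.mpr ha₃
  have hS : (p : ℚ) / ((a₁ : ℚ) * a₂ * a₃) ≠ 0 := by positivity
  have hb' : (b₁ : ℚ) / a₁ + b₂ / a₂ + b₃ / a₃ = p / ((a₁ : ℚ) * a₂ * a₃) := by
    have hbℚ : (b₁ : ℚ) * a₂ * a₃ + a₁ * b₂ * a₃ + a₁ * a₂ * b₃ = p := by exact_mod_cast hb
    field_simp
    linear_combination hbℚ
  have h₁' : (a₁ : ℚ) * σ₁ - b₁ * ρ₁ = 1 := by exact_mod_cast h₁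
  have h₂' : (a₂ : ℚ) * σ₂ - b₂ * ρ₂ = 1 := by exact_mod_cast h₂
  have h₃' : (a₃ : ℚ) * σ₃ - b₃ * ρ₃ = 1 := by exact_mod_cast h₃
  rw [auckly_expression_eq ha₁' ha₂' ha₃' hS hb' h₁' h₂' h₃', div_div_eq_mul_div]
  refine ⟨⟨-(b₁ * σ₁ + b₂ * σ₂ + b₃ * σ₃) - 2 * n₀, ?_⟩,
    ⟨-(n₀ ^ 2 * a₁ * a₂ * a₃), -(b₁ * σ₁ + b₂ * σ₂ + b₃ * σ₃) - 2 * n₀, ?_⟩⟩ <;>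
  · push_cast
    ring
end

section
/- Let p ≥ 7 be a prime and ζ ∈ ℂ a primitive p-th root of unity. For integers a, b coprime to p set L_ζ(a,b) = ((ζ^a + 1)/(ζ^a − 1)) · ((ζ^b + 1)/(ζ^b − 1)), where ζ^a denotes the integer power of the nonzero complex number ζ. Let P denote the list of seven integer pairs [(−4,5), (−3,4), (−2,3), (−2,3), (−1,2), (−1,2), (−1,2)]. Let (a_i, b_i) for i = 1,…,n be pairs of integers coprime to p, let λ_i (i = 1,…,n), λ̃_j (j = 1,…,7) and μ be integers, and let h ∈ ℤ[X] be a polynomial with p dividing h(1). Assume the two identities in ℂ: h(ζ) = Σ_{i=1}^n L_ζ(a_i,b_i)(ζ^{λ_i} + ζ^{−λ_i}) − Σ_{j=1}^7 L_ζ(P_j)(ζ^{λ̃_j} + ζ^{−λ̃_j}) − 8ζ(ζ^{μ} + ζ^{−μ})/(ζ − 1)², and Σ_{i=1}^n L_ζ(a_i,b_i) = Σ_{j=1}^7 L_ζ(P_j) + 8ζ/(ζ − 1)². Then in the field ZMod p (inverses taken in ZMod p): 4 Σ_{i=1}^n λ_i² (a_i b_i)⁻¹ = 4 Σ_{j=1}^7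 λ̃_j² (ã_j b̃_j)⁻¹ + 8μ², where (ã_j, b̃_j) = P_j. -/
open Finset

/-- The ring homomorphism `ℤ[X] → ℂ × ZMod p` sending `X` to `(ζ, 1)`. -/
noncomputable def evalPair (ζ : ℂ) (p : ℕ) : Polynomial ℤ →+* ℂ × ZMod p :=
  (Polynomial.aeval ζ).toRingHom.prod (Polynomial.eval₂RingHom (Int.castRingHom (ZMod p)) 1)

section

variable {p : ℕ} {ζ : ℂ}

lemma pair_mem_range (f : Polynomial ℤ) :
    (Polynomial.aeval ζ f, ((f.eval 1 : ℤ) : ZMod p)) ∈ (evalPair ζ p).range := by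
  refine ⟨f, Prod.ext rfl ?_⟩
  simp [evalPair]

/-- Reduction modulo `ζ - 1` is well defined on `ℤ[ζ]`. -/
lemma eq_zero_of_mem_range (hp : p.Prime) (hζ : IsPrimitiveRoot ζ p) {r : ZMod p}
    (hr : ((0 : ℂ), r) ∈ (evalPair ζ p).range) : r = 0 := by
  obtain ⟨f, hf⟩ := hr
  have := Fact.mk hp
  have h1 : Polynomial.aeval ζ f = 0 := congrArg Prod.fst hf
  have h2 : Polynomial.eval₂ (Int.castRingHom (ZMod p)) 1 f = r := congrArg Prod.snd hf
  have hd : Polynomial.cyclotomic p ℤ ∣ f := by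
    rw [Polynomial.cyclotomic_eq_minpoly hζ hp.pos]
    exact minpoly.isIntegrallyClosed_dvd (hζ.isIntegral hp.pos) h1
  obtain ⟨g, rfl⟩ := hd
  rw [← h2, Polynomial.eval₂_mul, ← Polynomial.eval_map, Polynomial.map_cyclotomic,
    Polynomial.eval_one_cyclotomic_prime]
  simp

lemma zpow_mem_range (hp : p.Prime) (hζ : IsPrimitiveRoot ζ p) (k : ℤ) :
    (ζ ^ k, (1 : ZMod p)) ∈ (evalPair ζ p).range := by
  have hp0 : (p : ℤ) ≠ 0 := by exact_mod_cast hp.ne_zero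
  obtain ⟨m, hm⟩ := Int.eq_ofNat_of_zero_le (Int.emod_nonneg k hp0)
  have hk : ζ ^ k = ζ ^ m := by
    rw [← Int.emod_add_mul_ediv k p, zpow_add₀ (hζ.ne_zero hp.ne_zero), zpow_mul, zpow_natCast,
      hζ.pow_eq_one, one_zpow, mul_one, hm, zpow_natCast]
  simpa [hk] using pair_mem_range (p := p) (ζ := ζ) (Polynomial.X ^ m)

lemma geom_sum_mem_range (hp : p.Prime) (hζ : IsPrimitiveRoot ζ p) (a : ℤ) (k : ℕ) :
    (∑ i ∈ range k, (ζ ^ a) ^ i, (k : ZMod p)) ∈ (evalPair ζ p).range := by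
  have h := Subring.sum_mem (evalPair ζ p).range (t := range k)
    (f := fun i => (((ζ ^ a) ^ i, 1) : ℂ × ZMod p)) fun i _ => by
      simpa using pow_mem (zpow_mem_range hp hζ a) i
  convert h using 1
  refine Prod.ext ?_ ?_ <;> simp [Prod.fst_sum, Prod.snd_sum]

lemma zpow_eq_zpow_of_cast_eq (hp : p.Prime) (hζ : IsPrimitiveRoot ζ p) {k l : ℤ}
    (h : (k : ZMod p) = l) : ζ ^ k = ζ ^ l := by
  have hd : (p : ℤ) ∣ k - l := by
    rw [← ZMod.intCast_zmod_eq_zero_iff_dvd, Int.cast_sub, h, sub_self]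
  have := (hζ.zpow_eq_one_iff_dvd _).2 hd
  rwa [zpow_sub₀ (hζ.ne_zero hp.ne_zero), div_eq_one_iff_eq
    (zpow_ne_zero _ (hζ.ne_zero hp.ne_zero))] at this

lemma not_dvd_of_isCoprime (hp : p.Prime) {a : ℤ} (ha : IsCoprime a (p : ℤ)) : ¬ (p : ℤ) ∣ a :=
  fun hd => (Nat.prime_iff_prime_int.1 hp).not_isUnit (ha.isUnit_of_dvd' hd dvd_rfl)

lemma zpow_sub_one_ne_zero (hp : p.Prime) (hζ : IsPrimitiveRoot ζ p) {a : ℤ}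
    (ha : IsCoprime a (p : ℤ)) : ζ ^ a - 1 ≠ 0 := by
  rw [sub_ne_zero, Ne, hζ.zpow_eq_one_iff_dvd]
  exact not_dvd_of_isCoprime hp ha

/-- For `a` coprime to `p`, the quotient `(ζ ^ k - 1) / (ζ ^ a - 1)` lies in `ℤ[ζ]` and reduces to
`k / a` modulo `ζ - 1`. -/
lemma zpow_sub_one_div_mem_range (hp : p.Prime) (hζ : IsPrimitiveRoot ζ p) {a : ℤ}
    (ha : IsCoprime a (p : ℤ)) (k : ℤ) :
    ((ζ ^ k - 1) / (ζ ^ a - 1), (k : ZMod p) * (a : ZMod p)⁻¹) ∈ (evalPair ζ p).range := by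
  have := Fact.mk hp
  have ha0 : (a : ZMod p) ≠ 0 := by
    rw [Ne, ZMod.intCast_zmod_eq_zero_iff_dvd]
    exact not_dvd_of_isCoprime hp ha
  set c : ℕ := ((k : ZMod p) * (a : ZMod p)⁻¹).val with hc
  have hcc : (c : ZMod p) = (k : ZMod p) * (a : ZMod p)⁻¹ := ZMod.natCast_zmod_val _
  have hk : ζ ^ k = (ζ ^ a) ^ c := by
    rw [← zpow_natCast, ← zpow_mul]
    apply zpow_eq_zpow_of_cast_eq hp hζ
    push_cast
    rw [hcc]
    field_simp
  have h := geom_sum_mem_range hp hζ a c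
  rwa [geom_sum_eq (sub_ne_zero.1 (zpow_sub_one_ne_zero hp hζ ha)), ← hk, hcc] at h

lemma Lz_mul_mem_range (hp : p.Prime) (hζ : IsPrimitiveRoot ζ p) {a b : ℤ}
    (ha : IsCoprime a (p : ℤ)) (hb : IsCoprime b (p : ℤ)) (l : ℤ) :
    (Lz ζ a b * (ζ ^ l + ζ ^ (-l) - 2),
      4 * (((l ^ 2 : ℤ) : ZMod p) * ((a * b : ℤ) : ZMod p)⁻¹)) ∈ (evalPair ζ p).range := by
  have hone := one_mem (evalPair ζ p).range
  have h := mul_mem (mul_mem (mul_mem (add_mem (zpow_mem_range hp hζ a) hone)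
    (add_mem (zpow_mem_range hp hζ b) hone)) (zpow_mem_range hp hζ (-l)))
    (mul_mem (zpow_sub_one_div_mem_range hp hζ ha l) (zpow_sub_one_div_mem_range hp hζ hb l))
  have := Fact.mk hp
  have h1 := zpow_sub_one_ne_zero hp hζ ha
  have h2 := zpow_sub_one_ne_zero hp hζ hb
  have h3 : ζ ^ l ≠ 0 := zpow_ne_zero _ (hζ.ne_zero hp.ne_zero)
  convert h using 1
  ext
  · simp only [Lz, zpow_neg, Prod.fst_mul, Prod.fst_add, Prod.fst_one]
    field_simp
    ring
  · simp only [Prod.snd_mul, Prod.snd_add, Prod.snd_one, Int.cast_mul, Int.cast_pow, mul_inv]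
    ring

lemma sphere_term_mem_range (hp : p.Prime) (hζ : IsPrimitiveRoot ζ p) (m : ℤ) :
    (8 * ζ * (ζ ^ m + ζ ^ (-m) - 2) / (ζ - 1) ^ 2, 8 * ((m ^ 2 : ℤ) : ZMod p)) ∈
      (evalPair ζ p).range := by
  have hq := zpow_sub_one_div_mem_range hp hζ isCoprime_one_left m
  have h := mul_mem (mul_mem (natCast_mem (evalPair ζ p).range 8)
    (mul_mem (zpow_mem_range hp hζ 1) (zpow_mem_range hp hζ (-m)))) (mul_mem hq hq)
  have := Fact.mk hp
  have h1 : ζ - 1 ≠ 0 := sub_ne_zero.2 (hζ.ne_one hp.one_lt)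
  have h3 : ζ ^ m ≠ 0 := zpow_ne_zero _ (hζ.ne_zero hp.ne_zero)
  convert h using 1
  ext
  · simp only [zpow_neg, zpow_one, Prod.fst_mul, Nat.cast_ofNat, Prod.fst_ofNat]
    field_simp
    ring
  · simp only [Prod.snd_mul, Prod.snd_ofNat, Int.cast_pow, Int.cast_one, inv_one,
      Nat.cast_ofNat]
    ring

lemma sum_Lz_mul_mem_range (hp : p.Prime) (hζ : IsPrimitiveRoot ζ p) {n : ℕ}
    {a b : Fin n → ℤ} (ha : ∀ i, IsCoprime (a i) (p : ℤ)) (hb : ∀ i, IsCoprime (b i) (p : ℤ))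
    (l : Fin n → ℤ) :
    (∑ i, Lz ζ (a i) (b i) * (ζ ^ l i + ζ ^ (-l i) - 2),
      4 * ∑ i, (((l i) ^ 2 : ℤ) : ZMod p) * ((a i * b i : ℤ) : ZMod p)⁻¹) ∈
      (evalPair ζ p).range := by
  have h := Subring.sum_mem (evalPair ζ p).range (t := univ)
    fun i _ => Lz_mul_mem_range hp hζ (ha i) (hb i) (l i)
  convert h using 1
  ext <;> simp [Prod.fst_sum, Prod.snd_sum, mul_sum]

lemma Pdata_isCoprime (hp : p.Prime) (hp7 : 7 ≤ p) (j : Fin 7) :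
    IsCoprime (Pdata j).1 (p : ℤ) ∧ IsCoprime (Pdata j).2 (p : ℤ) := by
  have key (x : ℤ) (h0 : x.natAbs ≠ 0) (h5 : x.natAbs ≤ 5) : IsCoprime x (p : ℤ) := by
    rw [Int.isCoprime_iff_gcd_eq_one, Int.gcd_eq_natAbs, Int.natAbs_natCast]
    exact (Nat.coprime_of_lt_prime h0 (by omega) hp).symm
  fin_cases j <;> exact ⟨key _ (by decide) (by decide), key _ (by decide) (by decide)⟩

end

/-- The twisted G-signature relation specialized to the `E8`-plumbing data:
`4Σᵢ λᵢ²/(aᵢbᵢ) ≡ 4Σⱼ λ̃ⱼ²/(ãⱼb̃ⱼ) + 8μ² (mod p)`. -/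
theorem stmt12 (p : ℕ) (hp : p.Prime) (hp7 : 7 ≤ p) (ζ : ℂ) (hζ : IsPrimitiveRoot ζ p)
    (n : ℕ) (a b lam : Fin n → ℤ) (lam' : Fin 7 → ℤ) (μ : ℤ)
    (ha : ∀ i, IsCoprime (a i) (p : ℤ)) (hb : ∀ i, IsCoprime (b i) (p : ℤ))
    (h : Polynomial ℤ) (hh1 : (p : ℤ) ∣ h.eval 1)
    (hid : Polynomial.aeval ζ h
        = ∑ i, Lz ζ (a i) (b i) * (ζ ^ (lam i) + ζ ^ (-(lam i)))
          - ∑ j, Lz ζ (Pdata j).1 (Pdata j).2 * (ζ ^ (lam' j) + ζ ^ (-(lam' j)))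
          - 8 * ζ * (ζ ^ μ + ζ ^ (-μ)) / (ζ - 1) ^ 2)
    (hid' : ∑ i, Lz ζ (a i) (b i)
        = ∑ j, Lz ζ (Pdata j).1 (Pdata j).2 + 8 * ζ / (ζ - 1) ^ 2) :
    4 * ∑ i, (((lam i) ^ 2 : ℤ) : ZMod p) * ((a i * b i : ℤ) : ZMod p)⁻¹
      = 4 * ∑ j, (((lam' j) ^ 2 : ℤ) : ZMod p)
          * (((Pdata j).1 * (Pdata j).2 : ℤ) : ZMod p)⁻¹
        + 8 * ((μ ^ 2 : ℤ) : ZMod p) := by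
  have hS := sum_Lz_mul_mem_range hp hζ ha hb lam
  have hT := sum_Lz_mul_mem_range hp hζ (fun j => (Pdata_isCoprime hp hp7 j).1)
    (fun j => (Pdata_isCoprime hp hp7 j).2) lam'
  have hU := sphere_term_mem_range hp hζ μ
  have hH := pair_mem_range (p := p) (ζ := ζ) h
  rw [(ZMod.intCast_zmod_eq_zero_iff_dvd _ _).2 hh1] at hH
  have hmem := sub_mem (sub_mem (sub_mem hS hT) hU) hH
  simp only [Prod.mk_sub_mk] at hmem
  rw [← sub_eq_zero, ← sub_sub]
  refine eq_zero_of_mem_range hp hζ ?_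
  convert hmem using 2
  · rw [hid]
    simp only [mul_sub, sum_sub_distrib, ← sum_mul, hid']
    ring
  · rw [sub_zero]
end
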